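/- Let u : ℝ × ℝ × ℝ × ℝ → ℝ be defined by u(t,x,y,z) = ((2/3)·π·exp(−π²t/3)·sin(π(x+y+z)/3)) / (5 + exp(−π²t/3)·cos(π(x+y+z)/3)). Then for every t ≥ 0 and all x, y, z ∈ ℝ, u satisfies the three-dimensional viscous Burgers' equation ∂u/∂t + u·(∂u/∂x + ∂u/∂y + ∂u/∂z) = ∂²u/∂x² + ∂²u/∂y² + ∂²u/∂z² at the point (t,x,y,z). -/

import Mathlib

open Real

/-- The paper's exact solution of the 3D viscous Burgers' equation:
`u(t,x,y,z) = ((2/3)·π·exp(−π²t/3)·sin(π(x+y+z)/3)) / (5 + exp(−π²t/3)·cos(π(x+y+z)/3))`. -/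
noncomputable def uBurgers : ℝ × ℝ × ℝ × ℝ → ℝ :=
  fun p =>
    ((2 / 3) * π * Real.exp (-π ^ 2 * p.1 / 3) *
        Real.sin (π * (p.2.1 + p.2.2.1 + p.2.2.2) / 3)) /
      (5 + Real.exp (-π ^ 2 * p.1 / 3) * Real.cos (π * (p.2.1 + p.2.2.1 + p.2.2.2) / 3))

/-- `uBurgers` at time `t` along `x + y + z = s`. -/
noncomputable def burgersProfile (t s : ℝ) : ℝ :=
  ((2 / 3) * π * Real.exp (-π ^ 2 * t / 3) * Real.sin (π * s / 3)) /
    (5 + Real.exp (-π ^ 2 * t / 3) * Real.cos (π * s / 3))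

/-- The spatial derivative of `burgersProfile`. -/
noncomputable def burgersProfileDeriv (t s : ℝ) : ℝ :=
  ((2 / 9) * π ^ 2 * Real.exp (-π ^ 2 * t / 3) *
      (5 * Real.cos (π * s / 3) + Real.exp (-π ^ 2 * t / 3))) /
    (5 + Real.exp (-π ^ 2 * t / 3) * Real.cos (π * s / 3)) ^ 2

lemma uBurgers_eq_burgersProfile (t x y z : ℝ) :
    uBurgers (t, x, y, z) = burgersProfile t (x + y + z) := rfl

lemma burgersProfile_denom_pos {t : ℝ} (ht : 0 ≤ t) (s : ℝ) :
    0 < 5 + Real.exp (-π ^ 2 * t / 3) * Real.cos (π * s / 3) := by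
  have h1 : Real.exp (-π ^ 2 * t / 3) ≤ 1 := by
    rw [Real.exp_le_one_iff]
    nlinarith [mul_nonneg (sq_nonneg π) ht]
  nlinarith [Real.exp_pos (-π ^ 2 * t / 3), Real.neg_one_le_cos (π * s / 3)]

lemma hasDerivAt_mul_div_three (a s : ℝ) : HasDerivAt (fun r : ℝ => a * r / 3) (a / 3) s := by
  simpa using ((hasDerivAt_id s).const_mul a).div_const 3

lemma hasDerivAt_burgersProfile {t : ℝ} (ht : 0 ≤ t) (s : ℝ) :
    HasDerivAt (burgersProfile t) (burgersProfileDeriv t s) s := by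
  have hD := (burgersProfile_denom_pos ht s).ne'
  have hl := hasDerivAt_mul_div_three π s
  refine HasDerivAt.congr_deriv ((hl.sin.const_mul ((2 / 3) * π * Real.exp (-π ^ 2 * t / 3))).fun_div
    ((hl.cos.const_mul (Real.exp (-π ^ 2 * t / 3))).const_add 5) hD) ?_
  unfold burgersProfileDeriv
  congr 1
  linear_combination ((2 / 9) * π ^ 2 * Real.exp (-π ^ 2 * t / 3) ^ 2) *
    Real.sin_sq_add_cos_sq (π * s / 3)

lemma hasDerivAt_burgersProfileDeriv {t : ℝ} (ht : 0 ≤ t) (s : ℝ) :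
    HasDerivAt (burgersProfileDeriv t)
      ((2 / 27) * π ^ 3 * Real.exp (-π ^ 2 * t / 3) * Real.sin (π * s / 3) *
        (2 * Real.exp (-π ^ 2 * t / 3) ^ 2 +
          5 * Real.exp (-π ^ 2 * t / 3) * Real.cos (π * s / 3) - 25) /
        (5 + Real.exp (-π ^ 2 * t / 3) * Real.cos (π * s / 3)) ^ 3) s := by
  have hD := (burgersProfile_denom_pos ht s).ne'
  have hl := hasDerivAt_mul_div_three π s
  refine HasDerivAt.congr_deriv ((((hl.cos.const_mul 5).add_const (Real.exp (-π ^ 2 * t / 3))).const_mul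
    ((2 / 9) * π ^ 2 * Real.exp (-π ^ 2 * t / 3))).fun_div
    (((hl.cos.const_mul (Real.exp (-π ^ 2 * t / 3))).const_add 5).fun_pow 2)
    (pow_ne_zero 2 hD)) ?_
  generalize Real.exp (-π ^ 2 * t / 3) = E at *
  generalize Real.cos (π * s / 3) = C at *
  field_simp
  ring

lemma hasDerivAt_burgersProfile_time {t : ℝ} (ht : 0 ≤ t) (s : ℝ) :
    HasDerivAt (fun τ => burgersProfile τ s)
      (-(10 / 9) * π ^ 3 * Real.exp (-π ^ 2 * t / 3) * Real.sin (π * s / 3) /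
        (5 + Real.exp (-π ^ 2 * t / 3) * Real.cos (π * s / 3)) ^ 2) t := by
  have hD := (burgersProfile_denom_pos ht s).ne'
  have he := (hasDerivAt_mul_div_three (-π ^ 2) t).exp
  refine HasDerivAt.congr_deriv (((he.const_mul ((2 / 3) * π)).mul_const (Real.sin (π * s / 3))).fun_div
    ((he.mul_const (Real.cos (π * s / 3))).const_add 5) hD) ?_
  congr 1
  ring

/-- `uBurgers` satisfies the 3D viscous Burgers' equation
`∂u/∂t + u·(∂u/∂x + ∂u/∂y + ∂u/∂z) = ∂²u/∂x² + ∂²u/∂y² + ∂²u/∂z²`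
at every point `(t,x,y,z)` with `t ≥ 0`. -/
theorem uBurgers_satisfies_burgers (t x y z : ℝ) (ht : 0 ≤ t) :
    deriv (fun τ => uBurgers (τ, x, y, z)) t +
      uBurgers (t, x, y, z) *
        (deriv (fun ξ => uBurgers (t, ξ, y, z)) x +
          deriv (fun η => uBurgers (t, x, η, z)) y +
          deriv (fun ζ => uBurgers (t, x, y, ζ)) z) =
    deriv (deriv (fun ξ => uBurgers (t, ξ, y, z))) x +
      deriv (deriv (fun η => uBurgers (t, x, η, z))) y +
      deriv (deriv (fun ζ => uBurgers (t, x, y, ζ))) z := by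
  have hx : (fun ξ => uBurgers (t, ξ, y, z)) = fun ξ => burgersProfile t (ξ + (y + z)) := by
    funext ξ
    rw [uBurgers_eq_burgersProfile, add_assoc]
  have hy : (fun η => uBurgers (t, x, η, z)) = fun η => burgersProfile t (η + (x + z)) := by
    funext η
    rw [uBurgers_eq_burgersProfile, add_left_comm, add_assoc]
  have hz : (fun ζ => uBurgers (t, x, y, ζ)) = fun ζ => burgersProfile t (ζ + (x + y)) := by
    funext ζ
    rw [uBurgers_eq_burgersProfile, add_comm]
  have hd : deriv (burgersProfile t) = burgersProfileDeriv t :=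
    funext fun s => (hasDerivAt_burgersProfile ht s).deriv
  have hshift (f : ℝ → ℝ) (c : ℝ) : deriv (fun r => f (r + c)) = fun r => deriv f (r + c) :=
    funext fun r => deriv_comp_add_const f c r
  have ex : x + (y + z) = x + y + z := by ring
  have ey : y + (x + z) = x + y + z := by ring
  have ez : z + (x + y) = x + y + z := by ring
  rw [hx, hy, hz]
  simp only [hshift, hd, ex, ey, ez, uBurgers_eq_burgersProfile,
    (hasDerivAt_burgersProfileDeriv ht _).deriv, (hasDerivAt_burgersProfile_time ht _).deriv]
  have hD := (burgersProfile_denom_pos ht (x + y + z)).ne'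
  unfold burgersProfile burgersProfileDeriv
  generalize Real.exp (-π ^ 2 * t / 3) = E at *
  generalize Real.cos (π * (x + y + z) / 3) = C at *
  field_simp
  ring
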